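/- Let q be a prime power, F the finite field with q elements, n ≥ 2 an integer, and δ ∈ [0,(q-1)/q). The rate R of every linearly recoverable (δ,n)-LRC sequence over F (not necessarily all-disjoint) satisfies R ≤ R̂_2(δ,n) := min over ω ∈ [δ/2,(q-1)/q] of the quantity R̂_0(ω,n) + R_opt(δ,ω). -/

import Mathlib

open Filter Set

noncomputable section

/-- Minimum (Hamming) distance of a code. -/
def minDist {K : Type} [DecidableEq K] {ι : Type} [Fintype ι] (C : Set (ι → K)) : ℕ :=
  sInf {d : ℕ | ∃ c ∈ C, ∃ c' ∈ C, c ≠ c' ∧ hammingDist c c' = d}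

/-- `Rg` exhibits `C` as a linearly recoverable LRC with locality `n - 1`. -/
def IsLinRecLRC {K : Type} [Field K] {N : ℕ} (C : Set (Fin N → K)) (n : ℕ)
    (Rg : Fin N → Finset (Fin N)) : Prop :=
  ∀ j : Fin N, j ∈ Rg j ∧ (Rg j).card ≤ n ∧
    ∃ a : Fin N → K, (∀ i, i ∉ (Rg j).erase j → a i = 0) ∧
      ∀ c ∈ C, c j = ∑ i, a i * c i

/-- `λ_q(ω,n)`. -/
def lambdaQ (q : ℕ) (ω : ℝ) (n : ℕ) : ℝ :=
  ⨅ z : Set.Ioc (0:ℝ) 1,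
    (-ω * Real.logb q (z : ℝ) - 1 / n +
      (1 / n) * Real.logb q ((1 + ((q:ℝ) - 1) * (z:ℝ)) ^ n + ((q:ℝ) - 1) * (1 - (z:ℝ)) ^ n))

/-- `R_0(ω,n) = (n-1)/n - λ_q(ω,n)`. -/
def R0 (q : ℕ) (ω : ℝ) (n : ℕ) : ℝ := ((n:ℝ) - 1) / n - lambdaQ q ω n

/-- The inner minimum `min_ϑ Σ_{s∈[n]} π_s·R_0(ϑ_s,s)` over nonnegative vectors `ϑ`
with `Σ_s π_s·ϑ_s = ω`. -/
def innerMin (q n : ℕ) (ω : ℝ) (π : ℕ → ℝ) : ℝ :=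
  sInf {t : ℝ | ∃ ϑ : ℕ → ℝ, (∀ s ∈ Finset.Icc 1 n, 0 ≤ ϑ s) ∧
    (∑ s ∈ Finset.Icc 1 n, π s * ϑ s) = ω ∧
    t = ∑ s ∈ Finset.Icc 1 n, π s * R0 q (ϑ s) s}

/-- `R̄_0(ω,n,μ)`. -/
def Rbar0 (q n : ℕ) (ω μ : ℝ) : ℝ :=
  sSup {r : ℝ | ∃ π : ℕ → ℝ, (∀ s ∈ Finset.Icc 1 n, 0 ≤ π s) ∧
    (∑ s ∈ Finset.Icc 1 n, π s) = 1 ∧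
    1 / μ ≤ (∑ s ∈ Finset.Icc 1 n, π s / (s : ℝ)) ∧
    r = innerMin q n ω π}

/-- `R̂_0(ω,n) = max_{ν ∈ [0,(n-1)/(n+1)]} [ ν + (1-ν)·R̄_0(ω/(1-ν), n, ((1-ν)/(1+ν))·n) ]`. -/
def Rhat0 (q n : ℕ) (ω : ℝ) : ℝ :=
  sSup {r : ℝ | ∃ ν : ℝ, ν ∈ Set.Icc (0:ℝ) (((n:ℝ) - 1) / ((n:ℝ) + 1)) ∧
    r = ν + (1 - ν) * Rbar0 q n (ω / (1 - ν)) (((1 - ν) / (1 + ν)) * n)}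

/-- `R_opt(δ,ω)`: the supremum of rates of infinite sequences of constant-weight codes
over `K` with relative minimum distance at least `δ` and relative codeword weight
tending to `ω`. -/
def RoptCW (K : Type) [Field K] [Fintype K] [DecidableEq K] (q : ℕ) (δ ω : ℝ) : ℝ :=
  sSup {R : ℝ | ∃ (N : ℕ → ℕ) (C : ∀ i : ℕ, Set (Fin (N i) → K)) (w : ℕ → ℕ),
    StrictMono N ∧ (∀ i, (C i).Nonempty) ∧
    (∀ i, ∀ c ∈ C i, hammingNorm c = w i) ∧
    Tendsto (fun i => (w i : ℝ) / (N i : ℝ)) atTop (nhds ω) ∧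
    δ ≤ liminf (fun i => (minDist (C i) : ℝ) / (N i : ℝ)) atTop ∧
    R = limsup (fun i => Real.logb q ((C i).ncard : ℝ) / (N i : ℝ)) atTop}


set_option linter.unusedSectionVars false

/-! ### Weight enumerators of single parity check codes -/

section WeightEnumerator

variable {ι K : Type} [Fintype ι] [DecidableEq ι] [Field K] [Fintype K] [DecidableEq K]

/-- The vectors whose support is contained in `G`. -/
def supportedOn (K : Type) [Field K] [Fintype K] [DecidableEq K] (G : Finset ι) :
    Finset (ι → K) :=
  Finset.univ.filter fun x => ∀ i, i ∉ G → x i = 0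

lemma mem_supportedOn {G : Finset ι} {x : ι → K} :
    x ∈ supportedOn K G ↔ ∀ i, i ∉ G → x i = 0 := by
  simp [supportedOn]

lemma sum_supportedOn_insert {M : Type} [AddCommMonoid M] {G : Finset ι} {j : ι} (hj : j ∉ G)
    (f : (ι → K) → M) :
    ∑ x ∈ supportedOn K (insert j G), f x =
      ∑ a : K, ∑ x ∈ supportedOn K G, f (Function.update x j a) := by
  rw [← Finset.sum_product']
  refine Finset.sum_nbij' (fun x => (x j, Function.update x j 0))
    (fun p => Function.update p.2 j p.1) ?_ ?_ ?_ ?_ ?_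
  · intro x hx
    rw [mem_supportedOn] at hx
    simp only [Finset.mem_product, Finset.mem_univ, true_and, mem_supportedOn]
    intro i hi
    by_cases hij : i = j
    · simp [hij]
    · simpa [hij] using hx i (by simp [hij, hi])
  · rintro ⟨a, x⟩ hx
    simp only [Finset.mem_product, Finset.mem_univ, true_and, mem_supportedOn] at hx
    rw [mem_supportedOn]
    intro i hi
    simp only [Finset.mem_insert, not_or] at hi
    simpa [hi.1] using hx i hi.2
  · intro x _
    simp
  · rintro ⟨a, x⟩ hx
    simp only [Finset.mem_product, Finset.mem_univ, true_and, mem_supportedOn] at hx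
    have h0 : x j = 0 := hx j hj
    simp [← h0]
  · intro x _
    simp

lemma hammingNorm_update_of_eq_zero {K : Type} [Field K] [DecidableEq K] {x : ι → K} {j : ι} (hx : x j = 0) (a : K) :
    hammingNorm (Function.update x j a) = hammingNorm x + if a = 0 then 0 else 1 := by
  by_cases ha : a = 0
  · have : Function.update x j a = x := by rw [ha, ← hx]; simp
    rw [this]; simp [ha]
  · have : (Finset.univ.filter fun i => Function.update x j a i ≠ 0) =
        insert j (Finset.univ.filter fun i => x i ≠ 0) := by
      ext i
      by_cases hij : i = j <;> simp [hij, ha]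
    rw [hammingNorm, this, Finset.card_insert_of_notMem (by simp [hx])]
    simp [ha, hammingNorm]

lemma sum_pow_indicator {R : Type} [CommRing R] (z : R) :
    ∑ a : K, z ^ (if a = 0 then 0 else 1) = 1 + ((Fintype.card K : R) - 1) * z := by
  rw [← Finset.add_sum_erase _ _ (Finset.mem_univ (0 : K))]
  rw [Finset.sum_congr rfl (g := fun _ => z)]
  · rw [Finset.sum_const, Finset.card_erase_of_mem (Finset.mem_univ _), Finset.card_univ,
      nsmul_eq_mul, Nat.cast_pred Fintype.card_pos]
    simp
  · intro a ha
    simp [Finset.ne_of_mem_erase ha]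

/-- The weight enumerator of the coset `{x | ∑ i ∈ G, h i * x i = b}` of a single parity check
code. -/
lemma card_mul_sum_parity_coset {R : Type} [CommRing R] (z : R) (h : ι → K) (G : Finset ι)
    (hG : ∀ i ∈ G, h i ≠ 0) (b : K) :
    (Fintype.card K : R) * ∑ x ∈ supportedOn K G,
        (if ∑ i ∈ G, h i * x i = b then z ^ hammingNorm x else 0) =
      (1 + ((Fintype.card K : R) - 1) * z) ^ G.card - (1 - z) ^ G.card +
        if b = 0 then (Fintype.card K : R) * (1 - z) ^ G.card else 0 := by
  induction G using Finset.induction_on generalizing b with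
  | empty =>
    have : supportedOn K (∅ : Finset ι) = {0} := by
      ext x
      simp [mem_supportedOn, funext_iff]
    rw [this]
    by_cases hb : b = 0
    · simp [hb]
    · simp [hb, Ne.symm hb]
  | insert j G hj ih =>
    have hGj : h j ≠ 0 := hG j (by simp)
    have ih' := ih fun i hi => hG i (by simp [hi])
    rw [sum_supportedOn_insert hj, Finset.card_insert_of_notMem hj]
    have step : ∀ a : K, ∑ x ∈ supportedOn K G,
        (if ∑ i ∈ insert j G, h i * Function.update x j a i = b
          then z ^ hammingNorm (Function.update x j a) else 0) =
        z ^ (if a = 0 then 0 else 1) * ∑ x ∈ supportedOn K G,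
          (if ∑ i ∈ G, h i * x i = b - h j * a then z ^ hammingNorm x else 0) := by
      intro a
      rw [Finset.mul_sum]
      refine Finset.sum_congr rfl fun x hx => ?_
      rw [mem_supportedOn] at hx
      have e : ∑ i ∈ G, h i * Function.update x j a i = ∑ i ∈ G, h i * x i := by
        refine Finset.sum_congr rfl fun i hi => ?_
        rw [Function.update_of_ne (by rintro rfl; exact hj hi)]
      rw [Finset.sum_insert hj, e, hammingNorm_update_of_eq_zero (hx j hj)]
      simp only [Function.update_self, eq_sub_iff_add_eq', pow_add, mul_ite, mul_zero]
      congr 1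
      ring
    rw [Finset.sum_congr rfl fun a _ => step a, Finset.mul_sum]
    have step2 : ∀ a : K, (Fintype.card K : R) * (z ^ (if a = 0 then 0 else 1) *
        ∑ x ∈ supportedOn K G,
          (if ∑ i ∈ G, h i * x i = b - h j * a then z ^ hammingNorm x else 0)) =
        z ^ (if a = 0 then 0 else 1) *
          ((1 + ((Fintype.card K : R) - 1) * z) ^ G.card - (1 - z) ^ G.card) +
        if a = b / h j then
          z ^ (if a = 0 then 0 else 1) * ((Fintype.card K : R) * (1 - z) ^ G.card) else 0 := by
      intro a
      rw [mul_left_comm, ih', mul_add]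
      congr 1
      have : b - h j * a = 0 ↔ a = b / h j := by
        rw [eq_div_iff hGj, sub_eq_zero, eq_comm, mul_comm]
      simp only [this, mul_ite, mul_zero]
    rw [Finset.sum_congr rfl fun a _ => step2 a, Finset.sum_add_distrib, ← Finset.sum_mul,
      sum_pow_indicator, Finset.sum_ite_eq' Finset.univ (b / h j)]
    by_cases hb : b = 0
    · simp [hb]; ring
    · simp [hb, hGj]; ring

end WeightEnumerator

/-! ### Mean and variance of a weight enumerator -/

section Moments

open Polynomial

/-- The operator `X · d/dX`. -/
def eulerOp (P : ℝ[X]) : ℝ[X] := X * derivative P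

/-- The mean of the distribution on `ℕ` with weights `coeff P k * z ^ k`. -/
def tiltedMean (P : ℝ[X]) (z : ℝ) : ℝ := (eulerOp P).eval z / P.eval z

/-- The variance of the distribution on `ℕ` with weights `coeff P k * z ^ k`. -/
def tiltedVar (P : ℝ[X]) (z : ℝ) : ℝ :=
  (eulerOp (eulerOp P)).eval z / P.eval z - tiltedMean P z ^ 2

lemma eulerOp_mul (P Q : ℝ[X]) : eulerOp (P * Q) = eulerOp P * Q + P * eulerOp Q := by
  simp only [eulerOp, derivative_mul]; ring

lemma eulerOp_add (P Q : ℝ[X]) : eulerOp (P + Q) = eulerOp P + eulerOp Q := by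
  simp only [eulerOp, derivative_add]; ring

lemma tiltedMean_mul {P Q : ℝ[X]} {z : ℝ} (hP : P.eval z ≠ 0) (hQ : Q.eval z ≠ 0) :
    tiltedMean (P * Q) z = tiltedMean P z + tiltedMean Q z := by
  simp only [tiltedMean, eulerOp_mul, eval_add, eval_mul]
  field_simp

lemma tiltedVar_mul {P Q : ℝ[X]} {z : ℝ} (hP : P.eval z ≠ 0) (hQ : Q.eval z ≠ 0) :
    tiltedVar (P * Q) z = tiltedVar P z + tiltedVar Q z := by
  simp only [tiltedVar, tiltedMean, eulerOp_mul, eulerOp_add, eval_add, eval_mul]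
  field_simp
  ring

lemma tiltedMean_prod {I : Type} (s : Finset I) {P : I → ℝ[X]} {z : ℝ}
    (hP : ∀ i, (P i).eval z ≠ 0) :
    tiltedMean (∏ i ∈ s, P i) z = ∑ i ∈ s, tiltedMean (P i) z := by
  classical
  induction s using Finset.induction_on with
  | empty => simp [tiltedMean, eulerOp]
  | insert i s hi ih =>
    rw [Finset.prod_insert hi, Finset.sum_insert hi, tiltedMean_mul (hP i), ih]
    rw [eval_prod]
    exact Finset.prod_ne_zero_iff.2 fun i _ => hP i

lemma tiltedVar_prod {I : Type} (s : Finset I) {P : I → ℝ[X]} {z : ℝ}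
    (hP : ∀ i, (P i).eval z ≠ 0) :
    tiltedVar (∏ i ∈ s, P i) z = ∑ i ∈ s, tiltedVar (P i) z := by
  classical
  induction s using Finset.induction_on with
  | empty => simp [tiltedVar, tiltedMean, eulerOp]
  | insert i s hi ih =>
    rw [Finset.prod_insert hi, Finset.sum_insert hi, tiltedVar_mul (hP i), ih]
    rw [eval_prod]
    exact Finset.prod_ne_zero_iff.2 fun i _ => hP i

/-- The generating polynomial of an `ℕ`-valued function on a finite set. -/
def genPoly {α : Type} (S : Finset α) (f : α → ℕ) : ℝ[X] := ∑ x ∈ S, X ^ f x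

variable {α : Type} (S : Finset α) (f : α → ℕ) (z : ℝ)

lemma eval_genPoly : (genPoly S f).eval z = ∑ x ∈ S, z ^ f x := by
  simp [genPoly, eval_finsetSum]

lemma eulerOp_X_pow (k : ℕ) : eulerOp (X ^ k) = C (k : ℝ) * X ^ k := by
  rcases k with _ | k
  · simp [eulerOp]
  · rw [eulerOp, derivative_X_pow, Nat.add_sub_cancel, pow_succ]; ring

lemma eulerOp_genPoly : eulerOp (genPoly S f) = ∑ x ∈ S, C (f x : ℝ) * X ^ f x := by
  rw [genPoly, eulerOp, derivative_sum, Finset.mul_sum]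
  exact Finset.sum_congr rfl fun x _ => eulerOp_X_pow _

lemma eval_eulerOp_genPoly :
    (eulerOp (genPoly S f)).eval z = ∑ x ∈ S, (f x : ℝ) * z ^ f x := by
  simp [eulerOp_genPoly, eval_finsetSum]

lemma eval_eulerOp_eulerOp_genPoly :
    (eulerOp (eulerOp (genPoly S f))).eval z = ∑ x ∈ S, (f x : ℝ) ^ 2 * z ^ f x := by
  rw [eulerOp_genPoly, eulerOp, derivative_sum, Finset.mul_sum, eval_finsetSum]
  refine Finset.sum_congr rfl fun x _ => ?_
  have : X * derivative (C (f x : ℝ) * X ^ f x) = C (f x : ℝ) * eulerOp (X ^ f x) := by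
    rw [derivative_C_mul, eulerOp]; ring
  rw [this, eulerOp_X_pow]
  simp only [eval_mul, eval_C, eval_pow, eval_X]
  ring

variable {S f z}

lemma one_le_eval_genPoly (hz : 0 ≤ z) (h0 : ∃ x ∈ S, f x = 0) :
    1 ≤ (genPoly S f).eval z := by
  obtain ⟨x, hx, hfx⟩ := h0
  rw [eval_genPoly]
  calc (1 : ℝ) = z ^ f x := by simp [hfx]
    _ ≤ _ := Finset.single_le_sum (f := fun x => z ^ f x) (fun _ _ => by positivity) hx

lemma tiltedVar_genPoly_le (hz : 0 ≤ z) (h0 : ∃ x ∈ S, f x = 0) {n : ℕ}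
    (hn : ∀ x ∈ S, f x ≤ n) : tiltedVar (genPoly S f) z ≤ (n : ℝ) ^ 2 := by
  have hpos := one_le_eval_genPoly hz h0
  have : (eulerOp (eulerOp (genPoly S f))).eval z / (genPoly S f).eval z ≤ (n : ℝ) ^ 2 := by
    rw [div_le_iff₀ (by linarith), eval_eulerOp_eulerOp_genPoly, eval_genPoly, Finset.mul_sum]
    refine Finset.sum_le_sum fun x hx => ?_
    have : (f x : ℝ) ≤ n := by exact_mod_cast hn x hx
    gcongr
  rw [tiltedVar]
  nlinarith [sq_nonneg (tiltedMean (genPoly S f) z)]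

/-- Chebyshev's inequality followed by the pigeonhole principle: some value `w` close to the mean
carries a `1 / (2 * (N + 1))` fraction of the total mass. -/
lemma exists_concentrated_value (hz : 0 ≤ z) (h0 : ∃ x ∈ S, f x = 0) {N : ℕ}
    (hN : ∀ x ∈ S, f x ≤ N) {κ : ℝ} (hκ : 0 < κ)
    (hvar : 2 * tiltedVar (genPoly S f) z ≤ κ ^ 2) :
    ∃ w : ℕ, |(w : ℝ) - tiltedMean (genPoly S f) z| < κ ∧
      (genPoly S f).eval z ≤ 2 * (N + 1) * ((S.filter fun x => f x = w).card * z ^ w) := by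
  have hpos := one_le_eval_genPoly hz h0
  set W := (genPoly S f).eval z with hW
  set m := tiltedMean (genPoly S f) z with hm
  have hW0 : 0 < W := by linarith
  have hmW : ∑ x ∈ S, (f x : ℝ) * z ^ f x = m * W := by
    rw [hm, tiltedMean, ← hW, div_mul_cancel₀ _ hW0.ne', eval_eulerOp_genPoly]
  have hvW : ∑ x ∈ S, (f x : ℝ) ^ 2 * z ^ f x = (tiltedVar (genPoly S f) z + m ^ 2) * W := by
    rw [tiltedVar, ← hm, ← hW, sub_add_cancel, div_mul_cancel₀ _ hW0.ne',
      eval_eulerOp_eulerOp_genPoly]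
  have hWs : W = ∑ x ∈ S, z ^ f x := eval_genPoly S f z
  have hcheb : ∑ x ∈ S, ((f x : ℝ) - m) ^ 2 * z ^ f x ≤ κ ^ 2 / 2 * W := by
    have : ∑ x ∈ S, ((f x : ℝ) - m) ^ 2 * z ^ f x = tiltedVar (genPoly S f) z * W := by
      have e : ∀ x ∈ S, ((f x : ℝ) - m) ^ 2 * z ^ f x =
          (f x : ℝ) ^ 2 * z ^ f x - 2 * m * ((f x : ℝ) * z ^ f x) + m ^ 2 * z ^ f x := by
        intro x _; ring
      rw [Finset.sum_congr rfl e, Finset.sum_add_distrib, Finset.sum_sub_distrib,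
        ← Finset.mul_sum, ← Finset.mul_sum, hmW, hvW, ← hWs]
      ring
    rw [this]
    gcongr
    linarith
  have hfar : κ ^ 2 * ∑ x ∈ S.filter (fun x => ¬ |(f x : ℝ) - m| < κ), z ^ f x ≤
      κ ^ 2 / 2 * W := by
    refine le_trans ?_ hcheb
    rw [Finset.mul_sum]
    refine le_trans (Finset.sum_le_sum fun x hx => ?_)
      (Finset.sum_le_sum_of_subset_of_nonneg (Finset.filter_subset _ S)
        fun x _ _ => by positivity)
    have hx' : κ ≤ |(f x : ℝ) - m| := not_lt.1 (Finset.mem_filter.1 hx).2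
    have : κ ^ 2 ≤ ((f x : ℝ) - m) ^ 2 := by
      rw [← sq_abs ((f x : ℝ) - m)]
      gcongr
    gcongr
  have hnear : W / 2 ≤ ∑ x ∈ S.filter (fun x => |(f x : ℝ) - m| < κ), z ^ f x := by
    have hsplit := Finset.sum_filter_add_sum_filter_not S (fun x => |(f x : ℝ) - m| < κ)
      fun x => z ^ f x
    have h2 : ∑ x ∈ S.filter (fun x => ¬ |(f x : ℝ) - m| < κ), z ^ f x ≤ W / 2 := by
      have : 0 < κ ^ 2 := by positivity
      refine le_of_mul_le_mul_left ?_ this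
      linarith
    linarith
  by_contra! hcon
  set S' := S.filter (fun x => |(f x : ℝ) - m| < κ) with hS'
  have hmaps : ∀ x ∈ S', f x ∈ Finset.range (N + 1) := fun x hx =>
    Finset.mem_range.2 (Nat.lt_succ_of_le (hN x (Finset.mem_filter.1 hx).1))
  rw [← Finset.sum_fiberwise_of_maps_to hmaps] at hnear
  have hlt : ∑ w ∈ Finset.range (N + 1), ∑ x ∈ S'.filter (fun x => f x = w), z ^ f x <
      ∑ w ∈ Finset.range (N + 1), W / (2 * (N + 1)) := by
    refine Finset.sum_lt_sum_of_nonempty (by simp) fun w _ => ?_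
    have e : ∑ x ∈ S'.filter (fun x => f x = w), z ^ f x =
        (S'.filter fun x => f x = w).card * z ^ w := by
      rw [Finset.sum_congr rfl (g := fun _ => z ^ w), Finset.sum_const, nsmul_eq_mul]
      intro x hx
      rw [(Finset.mem_filter.1 hx).2]
    rw [e]
    by_cases hw : |(w : ℝ) - m| < κ
    · rw [lt_div_iff₀ (by positivity), mul_comm]
      refine lt_of_le_of_lt ?_ (hcon w hw)
      gcongr
      exact Finset.filter_subset _ _
    · have : S'.filter (fun x => f x = w) = ∅ := by
        refine Finset.filter_eq_empty_iff.2 fun x hx hxw => hw ?_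
        rw [← hxw]
        exact (Finset.mem_filter.1 hx).2
      rw [this]
      simp only [Finset.card_empty, Nat.cast_zero, zero_mul]
      positivity
  rw [Finset.sum_const, Finset.card_range, nsmul_eq_mul] at hlt
  have : ((N + 1 : ℕ) : ℝ) * (W / (2 * (N + 1))) = W / 2 := by
    push_cast
    field_simp
  linarith

/-- Intermediate values of the mean. -/
lemma exists_tiltedMean_eq {P : ℝ[X]} (hP : ∀ z : ℝ, 0 ≤ z → P.eval z ≠ 0) {v : ℝ} (hv : 0 < v)
    (hv1 : v ≤ tiltedMean P 1) : ∃ z : ℝ, 0 < z ∧ z ≤ 1 ∧ tiltedMean P z = v := by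
  have hcont : ContinuousOn (tiltedMean P) (Set.Icc 0 1) := by
    unfold tiltedMean
    exact (eulerOp P).continuous.continuousOn.div P.continuous.continuousOn fun z hz => hP z hz.1
  have h0 : tiltedMean P 0 = 0 := by simp [tiltedMean, eulerOp]
  obtain ⟨z, hz, hzv⟩ := intermediate_value_Icc zero_le_one hcont
    (show v ∈ Set.Icc (tiltedMean P 0) (tiltedMean P 1) from ⟨by rw [h0]; exact hv.le, hv1⟩)
  refine ⟨z, lt_of_le_of_ne hz.1 ?_, hz.2, hzv⟩
  rintro rfl
  linarith

end Moments

/-! ### Lower bounds on the rate functions -/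

section RateFunctions

/-- `q` times the weight enumerator of the single parity check code of length `n`. -/
def parityEnum (q n : ℕ) (z : ℝ) : ℝ :=
  (1 + ((q:ℝ) - 1) * z) ^ n + ((q:ℝ) - 1) * (1 - z) ^ n

variable {q : ℕ}

lemma one_le_parityEnum (hq : 2 ≤ q) (n : ℕ) {z : ℝ} (hz : 0 < z) (hz1 : z ≤ 1) :
    1 ≤ parityEnum q n z := by
  have hq' : (2 : ℝ) ≤ q := by exact_mod_cast hq
  have h1 : 1 ≤ (1 + ((q:ℝ) - 1) * z) ^ n := one_le_pow₀ (by nlinarith)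
  have h2 : 0 ≤ ((q:ℝ) - 1) * (1 - z) ^ n :=
    mul_nonneg (by linarith) (pow_nonneg (by linarith) _)
  rw [parityEnum]
  linarith

lemma neg_inv_le_lambda_term (hq : 2 ≤ q) {θ : ℝ} (hθ : 0 ≤ θ) (s : ℕ)
    (z : Set.Ioc (0:ℝ) 1) :
    -(1 / (s : ℝ)) ≤ -θ * Real.logb q (z : ℝ) - 1 / s +
      (1 / s) * Real.logb q ((1 + ((q:ℝ) - 1) * (z:ℝ)) ^ s + ((q:ℝ) - 1) * (1 - (z:ℝ)) ^ s) := by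
  have hq' : (1 : ℝ) < q := by exact_mod_cast hq
  have h1 : 0 ≤ Real.logb q (parityEnum q s z) :=
    Real.logb_nonneg hq' (one_le_parityEnum hq s z.2.1 z.2.2)
  have h2 : Real.logb q (z : ℝ) ≤ 0 := Real.logb_nonpos hq' z.2.1.le z.2.2
  have h3 : 0 ≤ (1 / (s : ℝ)) * Real.logb q (parityEnum q s z) := by positivity
  have h4 : 0 ≤ -θ * Real.logb q (z : ℝ) := by nlinarith
  rw [parityEnum] at h3
  linarith

lemma R0_le_one (hq : 2 ≤ q) {θ : ℝ} (hθ : 0 ≤ θ) {s : ℕ} (hs : 1 ≤ s) : R0 q θ s ≤ 1 := by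
  have hl : -(1 / (s : ℝ)) ≤ lambdaQ q θ s := by
    have : Nonempty (Set.Ioc (0:ℝ) 1) := ⟨⟨1, by simp⟩⟩
    exact le_ciInf fun z => neg_inv_le_lambda_term hq hθ s z
  have hs' : (0 : ℝ) < s := by exact_mod_cast hs
  have : ((s : ℝ) - 1) / s = 1 - 1 / s := by field_simp
  rw [R0, this]
  linarith

lemma le_R0 (hq : 2 ≤ q) {θ : ℝ} (hθ : 0 ≤ θ) {s : ℕ} (hs : 1 ≤ s) {z : ℝ} (hz : 0 < z)
    (hz1 : z ≤ 1) :
    1 + θ * Real.logb q z - (1 / s) * Real.logb q (parityEnum q s z) ≤ R0 q θ s := by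
  have hb : lambdaQ q θ s ≤ -θ * Real.logb q z - 1 / s +
      (1 / s) * Real.logb q (parityEnum q s z) :=
    ciInf_le ⟨-(1 / (s : ℝ)), by
      rintro _ ⟨y, rfl⟩
      exact neg_inv_le_lambda_term hq hθ s y⟩ (⟨z, hz, hz1⟩ : Set.Ioc (0:ℝ) 1)
  have hs' : (0 : ℝ) < s := by exact_mod_cast hs
  have : ((s : ℝ) - 1) / s = 1 - 1 / s := by field_simp
  rw [R0, this]
  linarith

variable {n : ℕ} {ω : ℝ} {π : ℕ → ℝ}

lemma le_innerMin_term (hq : 2 ≤ q) (hπ : ∀ s ∈ Finset.Icc 1 n, 0 ≤ π s)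
    (hπ1 : ∑ s ∈ Finset.Icc 1 n, π s = 1) {z : ℝ} (hz : 0 < z) (hz1 : z ≤ 1)
    {ϑ : ℕ → ℝ} (hϑ : ∀ s ∈ Finset.Icc 1 n, 0 ≤ ϑ s)
    (hϑω : ∑ s ∈ Finset.Icc 1 n, π s * ϑ s = ω) :
    1 + ω * Real.logb q z -
        ∑ s ∈ Finset.Icc 1 n, π s * ((1 / s) * Real.logb q (parityEnum q s z)) ≤
      ∑ s ∈ Finset.Icc 1 n, π s * R0 q (ϑ s) s := by
  have : 1 + ω * Real.logb q z -
        ∑ s ∈ Finset.Icc 1 n, π s * ((1 / s) * Real.logb q (parityEnum q s z)) =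
      ∑ s ∈ Finset.Icc 1 n, π s *
        (1 + ϑ s * Real.logb q z - (1 / s) * Real.logb q (parityEnum q s z)) := by
    simp only [mul_sub, mul_add, mul_one, Finset.sum_sub_distrib, Finset.sum_add_distrib,
      ← mul_assoc, ← Finset.sum_mul, hπ1, hϑω]
  rw [this]
  exact Finset.sum_le_sum fun s hs => mul_le_mul_of_nonneg_left
    (le_R0 hq (hϑ s hs) (Finset.mem_Icc.1 hs).1 hz hz1) (hπ s hs)

lemma const_mem_innerMin_set (hω : 0 ≤ ω) (hπ1 : ∑ s ∈ Finset.Icc 1 n, π s = 1) :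
    ∑ s ∈ Finset.Icc 1 n, π s * R0 q ω s ∈
      {t : ℝ | ∃ ϑ : ℕ → ℝ, (∀ s ∈ Finset.Icc 1 n, 0 ≤ ϑ s) ∧
        (∑ s ∈ Finset.Icc 1 n, π s * ϑ s) = ω ∧
        t = ∑ s ∈ Finset.Icc 1 n, π s * R0 q (ϑ s) s} :=
  ⟨fun _ => ω, fun _ _ => hω, by rw [← Finset.sum_mul, hπ1, one_mul], rfl⟩

lemma le_innerMin (hq : 2 ≤ q) (hω : 0 ≤ ω) (hπ : ∀ s ∈ Finset.Icc 1 n, 0 ≤ π s)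
    (hπ1 : ∑ s ∈ Finset.Icc 1 n, π s = 1) {z : ℝ} (hz : 0 < z) (hz1 : z ≤ 1) :
    1 + ω * Real.logb q z -
        ∑ s ∈ Finset.Icc 1 n, π s * ((1 / s) * Real.logb q (parityEnum q s z)) ≤
      innerMin q n ω π := by
  refine le_csInf ⟨_, const_mem_innerMin_set hω hπ1⟩ ?_
  rintro _ ⟨ϑ, hϑ, hϑω, rfl⟩
  exact le_innerMin_term hq hπ hπ1 hz hz1 hϑ hϑω

lemma innerMin_le_one (hq : 2 ≤ q) (hω : 0 ≤ ω) (hπ : ∀ s ∈ Finset.Icc 1 n, 0 ≤ π s)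
    (hπ1 : ∑ s ∈ Finset.Icc 1 n, π s = 1) : innerMin q n ω π ≤ 1 := by
  refine le_trans (csInf_le ⟨1 + ω * Real.logb q 1 -
    ∑ s ∈ Finset.Icc 1 n, π s * ((1 / s) * Real.logb q (parityEnum q s 1)), ?_⟩
    (const_mem_innerMin_set hω hπ1)) ?_
  · rintro _ ⟨ϑ, hϑ, hϑω, rfl⟩
    exact le_innerMin_term hq hπ hπ1 one_pos le_rfl hϑ hϑω
  · calc ∑ s ∈ Finset.Icc 1 n, π s * R0 q ω s ≤ ∑ s ∈ Finset.Icc 1 n, π s * 1 :=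
          Finset.sum_le_sum fun s hs => mul_le_mul_of_nonneg_left
            (R0_le_one hq hω (Finset.mem_Icc.1 hs).1) (hπ s hs)
      _ = 1 := by simp [hπ1]

lemma Rbar0_le_one (hq : 2 ≤ q) (hω : 0 ≤ ω) (μ : ℝ) : Rbar0 q n ω μ ≤ 1 := by
  refine Real.sSup_le ?_ zero_le_one
  rintro _ ⟨π, hπ, hπ1, -, rfl⟩
  exact innerMin_le_one hq hω hπ hπ1

lemma innerMin_le_Rbar0 (hq : 2 ≤ q) (hω : 0 ≤ ω) {μ : ℝ}
    (hπ : ∀ s ∈ Finset.Icc 1 n, 0 ≤ π s) (hπ1 : ∑ s ∈ Finset.Icc 1 n, π s = 1)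
    (hμ : 1 / μ ≤ ∑ s ∈ Finset.Icc 1 n, π s / (s : ℝ)) :
    innerMin q n ω π ≤ Rbar0 q n ω μ := by
  refine le_csSup ⟨1, ?_⟩ ⟨π, hπ, hπ1, hμ, rfl⟩
  rintro _ ⟨π', hπ', hπ1', -, rfl⟩
  exact innerMin_le_one hq hω hπ' hπ1'

lemma le_Rhat0 (hq : 2 ≤ q) (hn : 2 ≤ n) (hω : 0 ≤ ω) {ν : ℝ}
    (hν : ν ∈ Set.Icc (0:ℝ) (((n:ℝ) - 1) / ((n:ℝ) + 1))) :
    ν + (1 - ν) * Rbar0 q n (ω / (1 - ν)) (((1 - ν) / (1 + ν)) * n) ≤ Rhat0 q n ω := by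
  refine le_csSup ⟨1, ?_⟩ ⟨ν, hν, rfl⟩
  rintro _ ⟨ν', hν', rfl⟩
  have hn' : (2 : ℝ) ≤ n := by exact_mod_cast hn
  have hlt : ν' < 1 := by
    refine lt_of_le_of_lt hν'.2 ?_
    rw [div_lt_one (by linarith)]
    linarith
  have := Rbar0_le_one (n := n) hq (div_nonneg hω (by linarith : 0 ≤ 1 - ν'))
    (((1 - ν') / (1 + ν')) * n)
  nlinarith

/-- The bound obtained from a partition of `N - T` coordinates into groups of sizes `s i ≤ n`,
the remaining `T` coordinates being covered at least twice. -/
lemma le_mul_Rhat0 (hq : 2 ≤ q) (hn : 2 ≤ n) (hω : 0 ≤ ω) {I : Type} [Fintype I] (s : I → ℕ)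
    (hs1 : ∀ i, 1 ≤ s i) (hsn : ∀ i, s i ≤ n) {N T : ℕ} (hN : 0 < N)
    (hNT : ∑ i, s i + T = N) (ht : N + T ≤ Fintype.card I * n) {z : ℝ} (hz : 0 < z)
    (hz1 : z ≤ 1) :
    N + ω * N * Real.logb q z - ∑ i, Real.logb q (parityEnum q (s i) z) ≤
      N * Rhat0 q n ω := by
  set M : ℕ := ∑ i, s i with hM
  set t : ℕ := Fintype.card I with ht'
  have htM : t ≤ M := by
    rw [hM, ht', Fintype.card_eq_sum_ones]
    exact Finset.sum_le_sum fun i _ => hs1 i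
  have htpos : 0 < t := by
    rcases Nat.eq_zero_or_pos t with h | h
    · rw [h] at ht; omega
    · exact h
  have hMpos : (0 : ℝ) < M := by exact_mod_cast (lt_of_lt_of_le htpos htM)
  have hNpos : (0 : ℝ) < N := by exact_mod_cast hN
  have hNT' : (M : ℝ) + T = N := by exact_mod_cast hNT
  have hT0 : (0 : ℝ) ≤ T := by positivity
  have ht2 : (N : ℝ) + T ≤ t * n := by exact_mod_cast ht
  have htM' : (t : ℝ) ≤ M := by exact_mod_cast htM
  have hn' : (2 : ℝ) ≤ n := by exact_mod_cast hn
  set π : ℕ → ℝ := fun k => k * (Finset.univ.filter fun i => s i = k).card / M with hπdef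
  have hsum : ∀ f : ℕ → ℝ, ∑ k ∈ Finset.Icc 1 n, π k * f k = (∑ i, s i * f (s i)) / M := by
    intro f
    rw [← Finset.sum_fiberwise_of_maps_to (s := Finset.univ) (t := Finset.Icc 1 n) (g := s)
      (fun i _ => Finset.mem_Icc.2 ⟨hs1 i, hsn i⟩), Finset.sum_div]
    refine Finset.sum_congr rfl fun k _ => ?_
    rw [Finset.sum_congr rfl (g := fun _ => (k : ℝ) * f k), Finset.sum_const, nsmul_eq_mul]
    · rw [hπdef]; ring
    · intro i hi
      rw [(Finset.mem_filter.1 hi).2]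
  have hπ : ∀ k ∈ Finset.Icc 1 n, 0 ≤ π k := fun k _ => by rw [hπdef]; positivity
  have hπ1 : ∑ k ∈ Finset.Icc 1 n, π k = 1 := by
    have := hsum fun _ => 1
    simp only [mul_one] at this
    rw [this, ← Nat.cast_sum, ← hM, div_self hMpos.ne']
  have hs0 : ∀ i, (s i : ℝ) ≠ 0 := fun i => by
    have := hs1 i
    positivity
  have hπs : ∑ k ∈ Finset.Icc 1 n, π k / (k : ℝ) = t / M := by
    simp only [div_eq_mul_inv]
    rw [hsum fun k => ((k : ℝ))⁻¹, Finset.sum_congr rfl fun i _ => mul_inv_cancel₀ (hs0 i)]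
    simp [ht', div_eq_mul_inv]
  have hπlog : ∑ k ∈ Finset.Icc 1 n, π k * ((1 / k) * Real.logb q (parityEnum q k z)) =
      (∑ i, Real.logb q (parityEnum q (s i) z)) / M := by
    rw [hsum fun k => (1 / k) * Real.logb q (parityEnum q k z)]
    congr 1
    refine Finset.sum_congr rfl fun i _ => ?_
    have := hs0 i
    field_simp
  set ν : ℝ := T / N with hν
  have h1ν : 1 - ν = M / N := by rw [hν, ← hNT']; field_simp; ring
  have h1ν' : 1 + ν = (N + T) / N := by rw [hν]; field_simp
  have hνmem : ν ∈ Set.Icc (0:ℝ) (((n:ℝ) - 1) / ((n:ℝ) + 1)) := by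
    refine ⟨by positivity, ?_⟩
    rw [hν, div_le_div_iff₀ hNpos (by linarith)]
    nlinarith
  have hω' : 0 ≤ ω / (1 - ν) := div_nonneg hω (by rw [h1ν]; positivity)
  have hμ : 1 / (((1 - ν) / (1 + ν)) * n) ≤ ∑ k ∈ Finset.Icc 1 n, π k / (k : ℝ) := by
    rw [hπs, h1ν, h1ν']
    have : 1 / ((M / N : ℝ) / ((N + T) / N) * n) = (N + T) / (M * n) := by field_simp
    rw [this, div_le_div_iff₀ (by positivity) hMpos]
    nlinarith
  have hmain := le_innerMin hq hω' hπ hπ1 hz hz1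
  have hR := le_Rhat0 hq hn hω hνmem
  have hB := innerMin_le_Rbar0 hq hω' hπ hπ1 hμ
  rw [hπlog] at hmain
  have hle : ν + (1 - ν) * (1 + ω / (1 - ν) * Real.logb q z -
      (∑ i, Real.logb q (parityEnum q (s i) z)) / M) ≤ Rhat0 q n ω := by
    refine le_trans ?_ hR
    have : 0 ≤ 1 - ν := by rw [h1ν]; positivity
    gcongr
    exact hmain.trans hB
  refine le_trans (le_of_eq ?_) (mul_le_mul_of_nonneg_left hle hNpos.le)
  rw [h1ν, hν, ← hNT']
  have : (M : ℝ) + T ≠ 0 := by positivity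
  field_simp
  ring

end RateFunctions

/-! ### Codes defined by overlapping parity checks -/

section OverlappingChecks

variable {ι K I : Type} [Fintype ι] [DecidableEq ι] [Field K] [Fintype K] [DecidableEq K]
  [Fintype I] [DecidableEq I]

lemma hammingNorm_add_of_disjoint {K : Type} [Field K] [DecidableEq K] {x y : ι → K}
    (hxy : ∀ j, x j = 0 ∨ y j = 0) :
    hammingNorm (x + y) = hammingNorm x + hammingNorm y := by
  rw [hammingNorm, hammingNorm, hammingNorm, ← Finset.card_union_of_disjoint]
  · congr 1
    ext j
    rcases hxy j with h | h <;> simp [h]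
  · rw [Finset.disjoint_filter]
    intro j _ hx hy
    rcases hxy j with h | h
    · exact hx h
    · exact hy h

lemma hammingNorm_sum_of_disjoint {K I : Type} [Field K] [DecidableEq K] [DecidableEq I]
    {p : I → ι → K} (hp : ∀ i k, i ≠ k → ∀ j, p i j = 0 ∨ p k j = 0) (s : Finset I) :
    hammingNorm (∑ i ∈ s, p i) = ∑ i ∈ s, hammingNorm (p i) := by
  induction s using Finset.induction_on with
  | empty => simp
  | insert i s hi ih =>
    rw [Finset.sum_insert hi, Finset.sum_insert hi, hammingNorm_add_of_disjoint, ih]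
    intro j
    by_cases h : p i j = 0
    · exact Or.inl h
    · right
      rw [Finset.sum_apply]
      refine Finset.sum_eq_zero fun k hk => ?_
      exact (hp i k (by rintro rfl; exact hi hk) j).resolve_left h

/-- The coordinates involved in check `i` and in no other check. -/
def privateCoords (h : I → ι → K) (i : I) : Finset ι :=
  Finset.univ.filter fun j => h i j ≠ 0 ∧ ∀ k, k ≠ i → h k j = 0

/-- The words supported on the private coordinates of check `i` that satisfy this check. -/
def privateCode (h : I → ι → K) (i : I) : Finset (ι → K) :=
  (supportedOn K (privateCoords h i)).filter fun x =>
    ∑ j ∈ privateCoords h i, h i j * x j = 0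

variable (h : I → ι → K)

lemma mem_privateCoords {i : I} {j : ι} :
    j ∈ privateCoords h i ↔ h i j ≠ 0 ∧ ∀ k, k ≠ i → h k j = 0 := by
  simp [privateCoords]

lemma privateCoords_disjoint {i k : I} (hik : i ≠ k) :
    Disjoint (privateCoords h i) (privateCoords h k) := by
  rw [Finset.disjoint_left]
  intro j hi hk
  rw [mem_privateCoords] at hi hk
  exact hk.1 (hi.2 k hik.symm)

lemma zero_mem_privateCode (i : I) : (0 : ι → K) ∈ privateCode h i := by
  simp [privateCode, mem_supportedOn]

lemma hammingNorm_le_of_mem_privateCode {i : I} {x : ι → K} (hx : x ∈ privateCode h i) :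
    hammingNorm x ≤ (privateCoords h i).card := by
  refine Finset.card_le_card fun j hj => ?_
  by_contra hji
  exact (Finset.mem_filter.1 hj).2 (mem_supportedOn.1 (Finset.mem_filter.1 hx).1 j hji)

lemma sum_mul_eq_zero_of_mem_privateCode {i : I} {x : ι → K} (hx : x ∈ privateCode h i) (k : I) :
    ∑ j, h k j * x j = 0 := by
  obtain ⟨hx1, hx2⟩ := Finset.mem_filter.1 hx
  rw [mem_supportedOn] at hx1
  rw [← Finset.sum_subset (Finset.subset_univ (privateCoords h i))
    (fun j _ hj => by rw [hx1 j hj, mul_zero])]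
  by_cases hik : k = i
  · rw [hik]; exact hx2
  · refine Finset.sum_eq_zero fun j hj => ?_
    rw [((mem_privateCoords h).1 hj).2 k hik, zero_mul]

lemma eq_zero_of_mem_privateCode_of_card_eq_one {i : I} (hi : (privateCoords h i).card = 1)
    {x : ι → K} (hx : x ∈ privateCode h i) : x = 0 := by
  obtain ⟨hx1, hx2⟩ := Finset.mem_filter.1 hx
  rw [mem_supportedOn] at hx1
  obtain ⟨j, hj⟩ := Finset.card_eq_one.1 hi
  have hjm : j ∈ privateCoords h i := by simp [hj]
  rw [hj, Finset.sum_singleton] at hx2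
  funext k
  by_cases hk : k = j
  · rw [hk]
    exact (mul_eq_zero.1 hx2).resolve_left ((mem_privateCoords h).1 hjm).1
  · exact hx1 k (by simp [hj, hk])

open Polynomial in
lemma card_mul_genPoly_privateCode (i : I) :
    (Fintype.card K : ℝ[X]) * genPoly (privateCode h i) hammingNorm =
      (1 + ((Fintype.card K : ℝ[X]) - 1) * X) ^ (privateCoords h i).card +
        ((Fintype.card K : ℝ[X]) - 1) * (1 - X) ^ (privateCoords h i).card := by
  have := card_mul_sum_parity_coset (X : ℝ[X]) (h i) (privateCoords h i)
    (fun j hj => ((mem_privateCoords h).1 hj).1) 0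
  rw [← Finset.sum_filter, if_pos rfl] at this
  rw [genPoly, privateCode, this]
  ring

lemma eval_genPoly_privateCode (i : I) (z : ℝ) :
    (genPoly (privateCode h i) hammingNorm).eval z =
      parityEnum (Fintype.card K) (privateCoords h i).card z / Fintype.card K := by
  have hq : (Fintype.card K : ℝ) ≠ 0 := by simp
  have := congrArg (Polynomial.eval z) (card_mul_genPoly_privateCode h i)
  simp only [Polynomial.eval_mul, Polynomial.eval_natCast, Polynomial.eval_add,
    Polynomial.eval_pow, Polynomial.eval_sub, Polynomial.eval_one, Polynomial.eval_X] at this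
  rw [eq_div_iff hq, parityEnum, ← this, mul_comm]

lemma tiltedMean_privateCode_one {i : I} (hi : 2 ≤ (privateCoords h i).card) :
    tiltedMean (genPoly (privateCode h i) hammingNorm) 1 =
      ((Fintype.card K : ℝ) - 1) / Fintype.card K * (privateCoords h i).card := by
  have hq : (Fintype.card K : ℝ) ≠ 0 := by simp
  have hd := congrArg (fun P => Polynomial.eval 1 (Polynomial.derivative P))
    (card_mul_genPoly_privateCode h i)
  obtain ⟨m, hm⟩ : ∃ m, (privateCoords h i).card = m + 2 := ⟨_, (Nat.sub_add_cancel hi).symm⟩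
  have he := eval_genPoly_privateCode h i 1
  rw [hm] at hd he
  simp only [Polynomial.derivative_mul, Polynomial.derivative_add, Polynomial.derivative_pow,
    Polynomial.derivative_natCast, Polynomial.derivative_sub, Polynomial.derivative_one,
    Polynomial.derivative_X, Polynomial.eval_mul, Polynomial.eval_natCast, Polynomial.eval_add,
    Polynomial.eval_pow, Polynomial.eval_sub, Polynomial.eval_one, Polynomial.eval_X,
    Polynomial.eval_zero, Polynomial.eval_C] at hd
  norm_num at hd
  simp only [parityEnum, sub_self, mul_one, add_sub_cancel, ne_eq, Nat.add_eq_zero_iff,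
    OfNat.ofNat_ne_zero, and_false, not_false_eq_true, zero_pow, mul_zero, add_zero] at he
  rw [tiltedMean, eulerOp, Polynomial.eval_mul, Polynomial.eval_X, one_mul, he, hm]
  have h2 : Polynomial.eval 1 (Polynomial.derivative (genPoly (privateCode h i) hammingNorm)) =
      ((m : ℝ) + 2) * (Fintype.card K : ℝ) ^ (m + 1) * ((Fintype.card K : ℝ) - 1) /
        Fintype.card K := by
    rw [eq_div_iff hq]
    linarith
  rw [h2]
  push_cast
  field_simp
  ring

/-- Choices of one word in the private code of each check. -/
def privateWords : Finset (I → ι → K) := Fintype.piFinset (privateCode h)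

lemma genPoly_privateWords :
    genPoly (privateWords h) (fun p => ∑ i, hammingNorm (p i)) =
      ∏ i, genPoly (privateCode h i) hammingNorm := by
  simp only [genPoly, privateWords, Finset.prod_univ_sum, Finset.prod_pow_eq_pow_sum]

variable {h} {p : I → ι → K}

lemma apply_eq_zero_of_mem_privateWords (hp : p ∈ privateWords h) {i : I} {j : ι}
    (hj : j ∉ privateCoords h i) : p i j = 0 :=
  mem_supportedOn.1 (Finset.mem_filter.1 (Fintype.mem_piFinset.1 hp i)).1 j hj

lemma disjoint_of_mem_privateWords (hp : p ∈ privateWords h) (i k : I) (hik : i ≠ k) (j : ι) :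
    p i j = 0 ∨ p k j = 0 := by
  by_cases hj : j ∈ privateCoords h i
  · exact Or.inr (apply_eq_zero_of_mem_privateWords hp
      (Finset.disjoint_left.1 (privateCoords_disjoint h hik) hj))
  · exact Or.inl (apply_eq_zero_of_mem_privateWords hp hj)

lemma sum_apply_of_mem_privateWords (hp : p ∈ privateWords h) {i : I} {j : ι}
    (hj : j ∈ privateCoords h i) : (∑ k, p k) j = p i j := by
  rw [Finset.sum_apply]
  refine Finset.sum_eq_single i (fun k _ hk => ?_) (by simp)
  exact apply_eq_zero_of_mem_privateWords hp
    (Finset.disjoint_left.1 (privateCoords_disjoint h hk.symm) hj)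

lemma sum_injOn_privateWords (h : I → ι → K) (y : ι → K) :
    Set.InjOn (fun p : I → ι → K => y + ∑ i, p i) (privateWords h) := by
  intro p hp p' hp' hpp
  have hpp' : ∑ i, p i = ∑ i, p' i := add_left_cancel hpp
  funext i j
  by_cases hj : j ∈ privateCoords h i
  · rw [← sum_apply_of_mem_privateWords hp hj, ← sum_apply_of_mem_privateWords hp' hj, hpp']
  · rw [apply_eq_zero_of_mem_privateWords hp hj, apply_eq_zero_of_mem_privateWords hp' hj]

lemma sum_card_privateCoords_le (h : I → ι → K) (s : Finset I) :
    ∑ i ∈ s, (privateCoords h i).card ≤ Fintype.card ι := by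
  rw [← Finset.card_biUnion fun i _ k _ hik => privateCoords_disjoint h hik]
  exact Finset.card_le_univ _

/-- The vectors satisfying all checks. -/
def checkCode (h : I → ι → K) : Finset (ι → K) :=
  Finset.univ.filter fun x => ∀ i, ∑ j, h i j * x j = 0

lemma mem_checkCode {h : I → ι → K} {x : ι → K} :
    x ∈ checkCode h ↔ ∀ i, ∑ j, h i j * x j = 0 := by
  simp [checkCode]

lemma sub_mem_checkCode {h : I → ι → K} {x y : ι → K} (hx : x ∈ checkCode h)
    (hy : y ∈ checkCode h) : x - y ∈ checkCode h := by
  rw [mem_checkCode] at *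
  intro i
  simp [mul_sub, Finset.sum_sub_distrib, hx i, hy i]

lemma card_checkCode_le (hpriv : ∀ i, (privateCoords h i).Nonempty) :
    (checkCode h).card ≤ Fintype.card K ^ (Fintype.card ι - Fintype.card I) := by
  choose g hg using hpriv
  have hg' : ∀ i, h i (g i) ≠ 0 ∧ ∀ k, k ≠ i → h k (g i) = 0 := fun i =>
    (mem_privateCoords h).1 (hg i)
  have hginj : Function.Injective g := by
    intro i k hik
    by_contra hne
    exact (hg' k).1 (hik ▸ (hg' i).2 k (Ne.symm hne))
  have hcard : Fintype.card ({j // j ∉ Finset.univ.image g} → K) =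
      Fintype.card K ^ (Fintype.card ι - Fintype.card I) := by
    rw [Fintype.card_fun, Fintype.card_subtype_compl, Fintype.card_coe,
      Finset.card_image_of_injective _ hginj, Finset.card_univ]
  rw [← hcard, ← Finset.card_univ]
  refine Finset.card_le_card_of_injOn (fun x j => x j) (by simp) ?_
  intro x hx y hy hxy
  have hd := mem_checkCode.1 (sub_mem_checkCode hx hy)
  have hoff : ∀ j, j ∉ Finset.univ.image g → x j - y j = 0 := fun j hj => by
    rw [sub_eq_zero]; exact congrFun hxy ⟨j, hj⟩
  funext j
  by_cases hj : j ∈ Finset.univ.image g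
  · obtain ⟨i, -, rfl⟩ := Finset.mem_image.1 hj
    have hi := hd i
    rw [Finset.sum_eq_single (g i)] at hi
    · exact sub_eq_zero.1 ((mul_eq_zero.1 hi).resolve_left (hg' i).1)
    · intro j _ hji
      by_cases hj' : j ∈ Finset.univ.image g
      · obtain ⟨k, -, rfl⟩ := Finset.mem_image.1 hj'
        rw [(hg' k).2 i (by rintro rfl; exact hji rfl), zero_mul]
      · rw [Pi.sub_apply, hoff j hj', mul_zero]
    · simp
  · exact sub_eq_zero.1 (hoff j hj)

/-- Averaging over translates by elements of a coset of the code. -/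
lemma exists_translate_card_le (h : I → ι → K) (D A : Finset (ι → K)) (y : ι → K)
    (hD : D ⊆ checkCode h) (hA : ∀ a ∈ A, a - y ∈ checkCode h) :
    ∃ x : ι → K, D.card * A.card ≤ (checkCode h).card * (D.filter fun c => c - x ∈ A).card := by
  have hne : (checkCode h).Nonempty := ⟨0, by simp [mem_checkCode]⟩
  have hcount : ∑ l ∈ checkCode h, (D.filter fun c => c - (l - y) ∈ A).card =
      D.card * A.card := by
    simp only [Finset.card_filter]
    rw [Finset.sum_comm, Finset.card_eq_sum_ones, Finset.sum_mul]
    refine Finset.sum_congr rfl fun c hc => ?_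
    rw [← Finset.card_filter, one_mul]
    refine Finset.card_nbij' (fun l => c - (l - y)) (fun a => c - (a - y)) ?_ ?_ ?_ ?_
    · intro l hl
      exact (Finset.mem_filter.1 hl).2
    · intro a ha
      rw [Finset.mem_coe, Finset.mem_filter]
      refine ⟨sub_mem_checkCode (hD hc) (hA a ha), ?_⟩
      have : c - (c - (a - y) - y) = a := by abel
      rwa [this]
    · intro l _
      show c - (c - (l - y) - y) = l
      abel
    · intro a _
      show c - (c - (a - y) - y) = a
      abel
  by_contra! hcon
  have : ∑ l ∈ checkCode h, (checkCode h).card * (D.filter fun c => c - (l - y) ∈ A).card <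
      ∑ l ∈ checkCode h, D.card * A.card :=
    Finset.sum_lt_sum_of_nonempty hne fun l _ => hcon (l - y)
  rw [← Finset.mul_sum, hcount, Finset.sum_const, smul_eq_mul] at this
  exact lt_irrefl _ this

end OverlappingChecks

/-! ### Large sets of check-code words of prescribed weight -/

section LargeSets

variable {ι K I : Type} [Fintype ι] [DecidableEq ι] [Field K] [Fintype K] [DecidableEq K]
  [Fintype I] [DecidableEq I] (h : I → ι → K)

lemma exists_translated_words (y : ι → K)
    (hy : ∀ p ∈ privateWords h, ∀ j, y j = 0 ∨ (∑ i, p i) j = 0) (w : ℕ) :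
    ∃ A : Finset (ι → K),
      A.card = ((privateWords h).filter fun p => ∑ i, hammingNorm (p i) = w).card ∧
      (∀ a ∈ A, hammingNorm a = hammingNorm y + w) ∧ ∀ a ∈ A, a - y ∈ checkCode h := by
  refine ⟨((privateWords h).filter fun p => ∑ i, hammingNorm (p i) = w).image
    fun p => y + ∑ i, p i, ?_, ?_, ?_⟩
  · exact Finset.card_image_of_injOn
      ((sum_injOn_privateWords h y).mono (Finset.coe_subset.2 (Finset.filter_subset _ _)))
  · intro a ha
    obtain ⟨p, hp, rfl⟩ := Finset.mem_image.1 ha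
    obtain ⟨hp, hpw⟩ := Finset.mem_filter.1 hp
    rw [hammingNorm_add_of_disjoint (hy p hp),
      hammingNorm_sum_of_disjoint (disjoint_of_mem_privateWords hp), hpw]
  · intro a ha
    obtain ⟨p, hp, rfl⟩ := Finset.mem_image.1 ha
    have hp := (Finset.mem_filter.1 hp).1
    rw [add_sub_cancel_left, mem_checkCode]
    intro i
    simp only [Finset.sum_apply, Finset.mul_sum]
    rw [Finset.sum_comm]
    exact Finset.sum_eq_zero fun k _ =>
      sum_mul_eq_zero_of_mem_privateCode h (Fintype.mem_piFinset.1 hp k) i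

/-- The generating polynomial of the total weight of a choice of private words. -/
def weightPoly : Polynomial ℝ :=
  genPoly (privateWords h) fun p => ∑ i, hammingNorm (p i)

lemma exists_zero_mem_privateWords :
    ∃ p ∈ privateWords h, ∑ i, hammingNorm (p i) = 0 :=
  ⟨0, Fintype.mem_piFinset.2 fun i => zero_mem_privateCode h i, by simp⟩

lemma one_le_eval_privateCode (i : I) {z : ℝ} (hz : 0 ≤ z) :
    1 ≤ (genPoly (privateCode h i) hammingNorm).eval z :=
  one_le_eval_genPoly hz ⟨0, zero_mem_privateCode h i, by simp⟩

lemma weight_le_card {p : I → ι → K} (hp : p ∈ privateWords h) :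
    ∑ i, hammingNorm (p i) ≤ Fintype.card ι := by
  rw [← hammingNorm_sum_of_disjoint (disjoint_of_mem_privateWords hp)]
  exact hammingNorm_le_card_fintype

lemma card_index_le (hpriv : ∀ i, (privateCoords h i).Nonempty) :
    Fintype.card I ≤ Fintype.card ι := by
  refine le_trans ?_ (sum_card_privateCoords_le h Finset.univ)
  rw [Fintype.card_eq_sum_ones]
  exact Finset.sum_le_sum fun i _ => (hpriv i).card_pos

lemma tiltedVar_weightPoly_le (hpriv : ∀ i, (privateCoords h i).Nonempty) {n : ℕ}
    (hn : ∀ i, (privateCoords h i).card ≤ n) {z : ℝ} (hz : 0 ≤ z) :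
    tiltedVar (weightPoly h) z ≤ Fintype.card ι * (n : ℝ) ^ 2 := by
  rw [weightPoly, genPoly_privateWords, tiltedVar_prod Finset.univ fun i =>
    (lt_of_lt_of_le one_pos (one_le_eval_privateCode h i hz)).ne']
  calc ∑ i, tiltedVar (genPoly (privateCode h i) hammingNorm) z
      ≤ ∑ _i : I, (n : ℝ) ^ 2 := Finset.sum_le_sum fun i _ =>
        tiltedVar_genPoly_le hz ⟨0, zero_mem_privateCode h i, by simp⟩ fun x hx =>
          (hammingNorm_le_of_mem_privateCode h hx).trans (hn i)
    _ = Fintype.card I * (n : ℝ) ^ 2 := by simp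
    _ ≤ _ := by
      have := card_index_le h hpriv
      gcongr

/-- The coordinates that are private to a check with at least two private coordinates. -/
def freeCoords : Finset ι :=
  (Finset.univ.filter fun i => 2 ≤ (privateCoords h i).card).biUnion (privateCoords h)

lemma tiltedMean_weightPoly_one (hpriv : ∀ i, (privateCoords h i).Nonempty) :
    tiltedMean (weightPoly h) 1 =
      ((Fintype.card K : ℝ) - 1) / Fintype.card K * (freeCoords h).card := by
  rw [weightPoly, genPoly_privateWords, tiltedMean_prod Finset.univ fun i =>
    (lt_of_lt_of_le one_pos (one_le_eval_privateCode h i zero_le_one)).ne']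
  rw [freeCoords, Finset.card_biUnion fun i _ k _ hik => privateCoords_disjoint h hik,
    Nat.cast_sum, Finset.mul_sum, Finset.sum_filter]
  refine Finset.sum_congr rfl fun i _ => ?_
  split_ifs with hi
  · exact tiltedMean_privateCode_one h hi
  · have h1 : (privateCoords h i).card = 1 := by
      have := (hpriv i).card_pos
      omega
    rw [tiltedMean, eval_eulerOp_genPoly, Finset.sum_eq_zero, zero_div]
    intro x hx
    rw [eq_zero_of_mem_privateCode_of_card_eq_one h h1 hx]
    simp

lemma sum_apply_eq_zero_of_notMem_freeCoords (hpriv : ∀ i, (privateCoords h i).Nonempty)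
    {p : I → ι → K} (hp : p ∈ privateWords h) {j : ι} (hj : j ∉ freeCoords h) :
    (∑ i, p i) j = 0 := by
  rw [Finset.sum_apply]
  refine Finset.sum_eq_zero fun i _ => ?_
  by_cases hi : 2 ≤ (privateCoords h i).card
  · refine apply_eq_zero_of_mem_privateWords hp fun hji => hj ?_
    exact Finset.mem_biUnion.2 ⟨i, by simp [hi], hji⟩
  · have h1 : (privateCoords h i).card = 1 := by
      have := (hpriv i).card_pos
      omega
    rw [eq_zero_of_mem_privateCode_of_card_eq_one h h1 (Fintype.mem_piFinset.1 hp i)]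
    rfl

/-- A coset of the code defined by the checks contains a large set of words whose common relative
weight is close to a prescribed value `ω`. -/
lemma exists_large_constantWeight_set (hpriv : ∀ i, (privateCoords h i).Nonempty) {n : ℕ}
    (hn1 : 1 ≤ n) (hn : ∀ i, (privateCoords h i).card ≤ n) (hι : 0 < Fintype.card ι) {ω : ℝ}
    (hω : 0 ≤ ω) (hω1 : ω ≤ ((Fintype.card K : ℝ) - 1) / Fintype.card K) {κ : ℝ}
    (hκ : κ = 2 * n * √(Fintype.card ι)) :
    ∃ (z : ℝ) (w : ℕ) (y : ι → K) (A : Finset (ι → K)), 0 < z ∧ z ≤ 1 ∧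
      (∀ a ∈ A, hammingNorm a = w) ∧ (∀ a ∈ A, a - y ∈ checkCode h) ∧
      |(w : ℝ) - ω * Fintype.card ι| ≤ 2 * κ + 1 ∧
      ∏ i, (parityEnum (Fintype.card K) (privateCoords h i).card z / Fintype.card K) ≤
        2 * (Fintype.card ι + 1) * (A.card * z ^ (ω * Fintype.card ι)) := by
  set N := Fintype.card ι with hN
  have hN' : (0 : ℝ) < N := by exact_mod_cast hι
  have hn1' : (0 : ℝ) < n := by exact_mod_cast hn1
  have hκ0 : 0 < κ := by rw [hκ]; positivity
  have hvar : ∀ z : ℝ, 0 ≤ z → 2 * tiltedVar (weightPoly h) z ≤ κ ^ 2 := by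
    intro z hz
    have := tiltedVar_weightPoly_le h hpriv hn hz
    have hsq : κ ^ 2 = 4 * (N * (n : ℝ) ^ 2) := by
      rw [hκ, mul_pow, mul_pow, Real.sq_sqrt hN'.le]; ring
    rw [hsq]
    have : 0 ≤ (N : ℝ) * (n : ℝ) ^ 2 := by positivity
    linarith
  have hconc : ∀ z : ℝ, 0 ≤ z → _ := fun z hz =>
    exists_concentrated_value (S := privateWords h) (f := fun p => ∑ i, hammingNorm (p i)) hz
      (exists_zero_mem_privateWords h) (fun p hp => weight_le_card h hp) hκ0 (hvar z hz)
  have heval : ∀ z : ℝ, (weightPoly h).eval z =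
      ∏ i, (parityEnum (Fintype.card K) (privateCoords h i).card z / Fintype.card K) := by
    intro z
    rw [weightPoly, genPoly_privateWords, Polynomial.eval_prod]
    exact Finset.prod_congr rfl fun i _ => eval_genPoly_privateCode h i z
  rcases le_or_gt (ω * N + κ) (tiltedMean (weightPoly h) 1) with hA | hB
  · obtain ⟨z, hz, hz1, hzv⟩ := exists_tiltedMean_eq (P := weightPoly h)
      (fun z hz => (lt_of_lt_of_le one_pos
        (one_le_eval_genPoly hz (exists_zero_mem_privateWords h))).ne')
      (by positivity) hA
    obtain ⟨w, hw, hWw⟩ := hconc z hz.le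
    change |(w : ℝ) - tiltedMean (weightPoly h) z| < κ at hw
    change (weightPoly h).eval z ≤ _ at hWw
    obtain ⟨A, hAcard, hAw, hAc⟩ := exists_translated_words h 0 (fun p _ j => Or.inl rfl) w
    rw [hzv, abs_lt] at hw
    refine ⟨z, w, 0, A, hz, hz1, fun a ha => by simpa using hAw a ha, hAc, ?_, ?_⟩
    · rw [abs_le]; constructor <;> linarith
    · rw [← heval, hAcard]
      refine hWw.trans ?_
      have : z ^ w ≤ z ^ (ω * N) := by
        rw [← Real.rpow_natCast]
        exact Real.rpow_le_rpow_of_exponent_ge hz hz1 (by linarith)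
      gcongr
  · obtain ⟨w, hw, hWw⟩ := hconc 1 zero_le_one
    change |(w : ℝ) - tiltedMean (weightPoly h) 1| < κ at hw
    change (weightPoly h).eval 1 ≤ _ at hWw
    have hmean := tiltedMean_weightPoly_one h hpriv
    set m := tiltedMean (weightPoly h) 1 with hm
    have hq1 : ((Fintype.card K : ℝ) - 1) / Fintype.card K ≤ 1 := by
      rw [div_le_one (by exact_mod_cast Fintype.card_pos)]
      linarith
    set k := ⌊ω * N - m⌋₊ with hk
    have hkF : k ≤ (freeCoords h)ᶜ.card := by
      rw [Finset.card_compl]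
      have hle : (freeCoords h).card ≤ N := Finset.card_le_univ _
      refine Nat.floor_le_of_le ?_
      rw [← hN, Nat.cast_sub hle, hmean]
      have : ((freeCoords h).card : ℝ) ≤ N := by exact_mod_cast hle
      nlinarith
    obtain ⟨B, hBsub, hBcard⟩ := Finset.exists_subset_card_eq hkF
    set y : ι → K := fun j => if j ∈ B then 1 else 0 with hy
    have hywt : hammingNorm y = k := by
      rw [← hBcard, hammingNorm]
      congr 1
      ext j
      simp [hy]
    obtain ⟨A, hAcard, hAw, hAc⟩ := exists_translated_words h y (fun p hp j => by
      by_cases hj : j ∈ B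
      · exact Or.inr (sum_apply_eq_zero_of_notMem_freeCoords h hpriv hp
          (Finset.mem_compl.1 (hBsub hj)))
      · exact Or.inl (by simp [hy, hj])) w
    refine ⟨1, k + w, y, A, one_pos, le_rfl, fun a ha => by rw [hAw a ha, hywt], hAc, ?_, ?_⟩
    · rw [abs_lt] at hw
      push_cast
      rcases le_or_gt 0 (ω * N - m) with hpos | hneg
      · have h1 := Nat.floor_le hpos
        have h2 := Nat.lt_floor_add_one (ω * N - m)
        rw [abs_le]; constructor <;> linarith
      · have : k = 0 := Nat.floor_of_nonpos hneg.le
        rw [this, Nat.cast_zero, abs_le]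
        constructor <;> linarith
    · rw [← heval, hAcard]
      simpa using hWw

end LargeSets

/-! ### Translating a code into a constant-weight code -/

section FiniteLength

variable {K : Type} [Field K] [Fintype K] [DecidableEq K]

/-- The parity checks of a linearly recoverable code, thinned out to a minimal cover. -/
lemma exists_minimal_checks {N n : ℕ} {C : Set (Fin N → K)} {Rg : Fin N → Finset (Fin N)}
    (hC : IsLinRecLRC C n Rg) :
    ∃ (s : Finset (Fin N)) (h : s → Fin N → K),
      (∀ i, (Finset.univ.filter fun j => h i j ≠ 0).card ≤ n) ∧
      (∀ j, ∃ i, h i j ≠ 0) ∧ (∀ i, (privateCoords h i).Nonempty) ∧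
      ∀ c ∈ C, c ∈ checkCode h := by
  choose hmem hcard a ha hrec using hC
  set g : Fin N → Fin N → K := fun i j => if j = i then 1 else -(a i j) with hg
  have hgC : ∀ i, ∀ c ∈ C, ∑ j, g i j * c j = 0 := by
    intro i c hc
    have hii : a i i = 0 := ha i i (by simp)
    have e : ∀ j, g i j * c j = (if j = i then c j else 0) - a i j * c j := by
      intro j
      by_cases hj : j = i
      · simp [hg, hj, hii]
      · simp [hg, hj]
    simp only [e, Finset.sum_sub_distrib, Finset.sum_ite_eq', Finset.mem_univ, if_true]
    rw [← hrec i c hc, sub_self]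
  have hgn : ∀ i, (Finset.univ.filter fun j => g i j ≠ 0).card ≤ n := by
    intro i
    refine le_trans (Finset.card_le_card fun j hj => ?_) (hcard i)
    by_contra hji
    have hne : j ≠ i := by rintro rfl; exact hji (hmem j)
    refine (Finset.mem_filter.1 hj).2 ?_
    simp [hg, hne, ha i j (by simp [hji])]
  obtain ⟨s, hs⟩ := Set.Finite.exists_minimal
    (s := {s : Finset (Fin N) | ∀ j, ∃ i ∈ s, g i j ≠ 0}) (Set.toFinite _)
    ⟨Finset.univ, fun j => ⟨j, Finset.mem_univ j, by simp [hg]⟩⟩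
  refine ⟨s, fun i => g i, fun i => hgn i, fun j => ?_, fun i => ?_, fun c hc => ?_⟩
  · obtain ⟨i, hi, hij⟩ := hs.1 j
    exact ⟨⟨i, hi⟩, hij⟩
  · by_contra hempty
    have hcov : s.erase i ∈ {s : Finset (Fin N) | ∀ j, ∃ i ∈ s, g i j ≠ 0} := by
      intro j
      by_contra! hj
      obtain ⟨k, hk, hkj⟩ := hs.1 j
      have hki : k = i := by
        by_contra hne
        exact hkj (hj k (Finset.mem_erase.2 ⟨hne, hk⟩))
      refine hempty ⟨j, (mem_privateCoords _).2 ⟨hki ▸ hkj, fun l hl => ?_⟩⟩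
      exact hj l (Finset.mem_erase.2 ⟨fun h => hl (Subtype.ext h), l.2⟩)
    have := hs.2 hcov (Finset.erase_subset _ _) i.2
    simp at this
  · exact mem_checkCode.2 fun i => hgC i c hc

/-- Every coordinate that is not private to a check is involved in at least two checks. -/
lemma card_add_card_nonprivate_le {ι I : Type} [Fintype ι] [DecidableEq ι] [Fintype I]
    [DecidableEq I] {h : I → ι → K} {n : ℕ}
    (hn : ∀ i, (Finset.univ.filter fun j => h i j ≠ 0).card ≤ n) (hcov : ∀ j, ∃ i, h i j ≠ 0) :
    Fintype.card ι + (Finset.univ.biUnion (privateCoords h))ᶜ.card ≤ Fintype.card I * n := by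
  have h1 : ∑ i, (Finset.univ.filter fun j => h i j ≠ 0).card ≤ Fintype.card I * n := by
    calc _ ≤ ∑ _i : I, n := Finset.sum_le_sum fun i _ => hn i
      _ = _ := by simp
  refine le_trans ?_ h1
  have h2 : ∑ i, (Finset.univ.filter fun j => h i j ≠ 0).card =
      ∑ j, (Finset.univ.filter fun i => h i j ≠ 0).card := by
    simp only [Finset.card_filter]
    exact Finset.sum_comm
  have h3 : Fintype.card ι + (Finset.univ.biUnion (privateCoords h))ᶜ.card =
      ∑ j, (1 + if j ∈ (Finset.univ.biUnion (privateCoords h))ᶜ then 1 else 0) := by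
    rw [Finset.sum_add_distrib, Finset.sum_ite_mem]
    simp
  rw [h2, h3]
  refine Finset.sum_le_sum fun j _ => ?_
  obtain ⟨i, hi⟩ := hcov j
  split_ifs with hj
  · have hj' : j ∉ privateCoords h i := fun hji =>
      (Finset.mem_compl.1 hj) (Finset.mem_biUnion.2 ⟨i, Finset.mem_univ i, hji⟩)
    rw [mem_privateCoords] at hj'
    push Not at hj'
    obtain ⟨k, hki, hkj⟩ := hj' hi
    exact Finset.one_lt_card.2 ⟨k, by simp [hkj], i, by simp [hi], hki⟩
  · exact Finset.card_pos.2 ⟨i, by simp [hi]⟩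

/-- A linearly recoverable code contains, up to translation, a large constant-weight code. -/
lemma exists_constantWeight_subcode {q : ℕ} (hq : Fintype.card K = q) {n : ℕ} (hn : 2 ≤ n)
    {ω : ℝ} (hω : 0 ≤ ω) (hω1 : ω ≤ ((q : ℝ) - 1) / q) {N : ℕ} (hN : 0 < N)
    {C : Set (Fin N → K)} (hne : C.Nonempty) {Rg : Fin N → Finset (Fin N)}
    (hC : IsLinRecLRC C n Rg) :
    ∃ (w : ℕ) (D : Set (Fin N → K)) (x : Fin N → K), D.Nonempty ∧
      (∀ c ∈ D, hammingNorm c = w) ∧ (∀ c ∈ D, c + x ∈ C) ∧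
      |(w : ℝ) - ω * N| ≤ 4 * n * √N + 1 ∧
      Real.logb q C.ncard ≤ Real.logb q D.ncard + N * Rhat0 q n ω +
        Real.logb q (2 * (N + 1)) := by
  classical
  have hq2 : 2 ≤ q := hq ▸ Fintype.one_lt_card
  have hq1 : (1 : ℝ) < q := by exact_mod_cast hq2
  have hq0 : (0 : ℝ) < q := by linarith
  obtain ⟨s, h, hhn, hcov, hpriv, hCh⟩ := exists_minimal_checks hC
  have hsn : ∀ i, (privateCoords h i).card ≤ n := fun i =>
    (Finset.card_le_card fun j hj => by
      simpa using ((mem_privateCoords h).1 hj).1).trans (hhn i)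
  obtain ⟨z, w, y, A, hz, hz1, hAw, hAc, hwω, hbig⟩ :=
    exists_large_constantWeight_set h hpriv (by omega : 1 ≤ n) hsn (by simpa using hN) hω
      (by rw [hq]; exact hω1) rfl
  rw [Fintype.card_fin] at hwω hbig
  rw [hq] at hbig
  set T := (Finset.univ.biUnion (privateCoords h))ᶜ.card with hT
  have hNT : ∑ i, (privateCoords h i).card + T = N := by
    rw [← Finset.card_biUnion fun i _ k _ hik => privateCoords_disjoint h hik, hT,
      Finset.card_add_card_compl, Fintype.card_fin]
  have htn : N + T ≤ Fintype.card s * n := by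
    have := card_add_card_nonprivate_le hhn hcov
    rwa [Fintype.card_fin] at this
  have hrate := le_mul_Rhat0 hq2 hn hω (fun i => (privateCoords h i).card)
    (fun i => (hpriv i).card_pos) hsn hN hNT htn hz hz1
  have hCfin : C.Finite := Set.toFinite C
  obtain ⟨x, hx⟩ := exists_translate_card_le h hCfin.toFinset A y
    (fun c hc => hCh c (hCfin.mem_toFinset.1 hc)) hAc
  set E := hCfin.toFinset.filter fun c => c - x ∈ A with hE
  have hEpos_of : 0 < hCfin.toFinset.card * A.card → 0 < E.card := fun hpos =>
    Nat.pos_of_mul_pos_left (lt_of_lt_of_le hpos hx)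
  have hparity : ∀ i, 0 < parityEnum q (privateCoords h i).card z := fun i =>
    lt_of_lt_of_le one_pos (one_le_parityEnum hq2 _ hz hz1)
  have hprodpos : 0 < ∏ i, (parityEnum q (privateCoords h i).card z / q) :=
    Finset.prod_pos fun i _ => div_pos (hparity i) hq0
  have hApos : 0 < A.card := by
    rcases Nat.eq_zero_or_pos A.card with h0 | h0
    · rw [h0] at hbig
      simp only [Nat.cast_zero, zero_mul, mul_zero] at hbig
      linarith
    · exact h0
  have hDpos : 0 < hCfin.toFinset.card := by
    obtain ⟨c, hc⟩ := hne
    exact Finset.card_pos.2 ⟨c, hCfin.mem_toFinset.2 hc⟩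
  have hEpos : 0 < E.card := hEpos_of (Nat.mul_pos hDpos hApos)
  have hDcard : ((fun c => c - x) '' (E : Set (Fin N → K))).ncard = E.card := by
    rw [Set.ncard_image_of_injective _ (sub_left_injective), Set.ncard_coe_finset]
  refine ⟨w, (fun c => c - x) '' (E : Set (Fin N → K)), x, ?_, ?_, ?_, ?_, ?_⟩
  · obtain ⟨c, hc⟩ := Finset.card_pos.1 hEpos
    exact ⟨_, c, hc, rfl⟩
  · rintro _ ⟨c, hc, rfl⟩
    exact hAw _ (Finset.mem_filter.1 hc).2
  · rintro _ ⟨c, hc, rfl⟩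
    simpa using hCfin.mem_toFinset.1 (Finset.mem_filter.1 hc).1
  · linarith
  · rw [hDcard, Set.ncard_eq_toFinset_card C hCfin]
    set t := Fintype.card s with ht
    have htN : t ≤ N := by
      have := card_index_le h hpriv
      rwa [Fintype.card_fin] at this
    have hL : ((checkCode h).card : ℝ) ≤ (q : ℝ) ^ ((N : ℝ) - t) := by
      rw [← Nat.cast_sub htN, Real.rpow_natCast]
      have := card_checkCode_le hpriv
      rw [hq, Fintype.card_fin] at this
      exact_mod_cast this
    have hx' : (hCfin.toFinset.card : ℝ) * A.card ≤ (q : ℝ) ^ ((N : ℝ) - t) * E.card := by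
      refine le_trans (by exact_mod_cast hx) (mul_le_mul_of_nonneg_right hL (by positivity))
    have hD' : (0 : ℝ) < hCfin.toFinset.card := by exact_mod_cast hDpos
    have hA' : (0 : ℝ) < A.card := by exact_mod_cast hApos
    have hE' : (0 : ℝ) < E.card := by exact_mod_cast hEpos
    have hlog1 := Real.logb_le_logb_of_le hq1 (by positivity) hx'
    rw [Real.logb_mul hD'.ne' hA'.ne', Real.logb_mul (by positivity) hE'.ne',
      Real.logb_rpow hq0 hq1.ne'] at hlog1
    have hlog2 := Real.logb_le_logb_of_le hq1 hprodpos hbig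
    have hzpos : 0 < z ^ (ω * N) := Real.rpow_pos_of_pos hz _
    rw [Real.logb_mul (by positivity) (by positivity), Real.logb_mul hA'.ne' hzpos.ne',
      Real.logb_rpow_eq_mul_logb_of_pos hz,
      Real.logb_prod _ _ fun i _ => (div_pos (hparity i) hq0).ne'] at hlog2
    have hsum : ∑ i, Real.logb q (parityEnum q (privateCoords h i).card z / q) =
        ∑ i, Real.logb q (parityEnum q (privateCoords h i).card z) - t := by
      rw [Finset.sum_congr rfl fun i _ => Real.logb_div (hparity i).ne' hq0.ne',
        Finset.sum_sub_distrib, Real.logb_self_eq_one hq1]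
      simp [ht]
    rw [hsum] at hlog2
    linarith

end FiniteLength

/-! ### Asymptotics -/

section Asymptotics

variable {K : Type} [DecidableEq K]

lemma minDist_le {ι : Type} [Fintype ι] (C : Set (ι → K)) : minDist C ≤ Fintype.card ι := by
  rcases Set.eq_empty_or_nonempty
    {d : ℕ | ∃ c ∈ C, ∃ c' ∈ C, c ≠ c' ∧ hammingDist c c' = d} with he | ⟨d, hd⟩
  · rw [minDist, he]; simp
  · refine (Nat.sInf_le hd).trans ?_
    obtain ⟨c, -, c', -, -, rfl⟩ := hd
    exact hammingDist_le_card_fintype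

lemma minDist_le_of_translate [Field K] {ι : Type} [Fintype ι] {C D : Set (ι → K)} {x : ι → K}
    (hD : ∀ c ∈ D, c + x ∈ C) (hnt : D.Nontrivial) : minDist C ≤ minDist D := by
  have hne : {d : ℕ | ∃ c ∈ D, ∃ c' ∈ D, c ≠ c' ∧ hammingDist c c' = d}.Nonempty := by
    obtain ⟨c, hc, c', hc', hcc⟩ := hnt
    exact ⟨_, c, hc, c', hc', hcc, rfl⟩
  obtain ⟨c, hc, c', hc', hcc, hd⟩ := Nat.sInf_mem hne
  have hmem : minDist D ∈ {d : ℕ | ∃ c ∈ C, ∃ c' ∈ C, c ≠ c' ∧ hammingDist c c' = d} :=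
    ⟨c + x, hD c hc, c' + x, hD c' hc', fun h => hcc (add_right_cancel h), by
      rw [minDist, ← hd]
      simp [hammingDist]⟩
  exact Nat.sInf_le hmem

lemma minDist_div_le_one {N : ℕ} (C : Set (Fin N → K)) : (minDist C : ℝ) / N ≤ 1 := by
  refine div_le_one_of_le₀ ?_ (Nat.cast_nonneg N)
  have := minDist_le C
  rw [Fintype.card_fin] at this
  exact_mod_cast this

variable [Fintype K]

lemma rate_nonneg {q : ℕ} (hq : 1 < q) {N : ℕ} (C : Set (Fin N → K)) :
    0 ≤ Real.logb q (C.ncard : ℝ) / N := by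
  refine div_nonneg ?_ (Nat.cast_nonneg N)
  rcases Nat.eq_zero_or_pos C.ncard with h | h
  · simp [h]
  · exact Real.logb_nonneg (by exact_mod_cast hq) (by exact_mod_cast h)

lemma rate_le_one {q : ℕ} (hcard : Fintype.card K = q) (hq : 1 < q) {N : ℕ}
    (C : Set (Fin N → K)) : Real.logb q (C.ncard : ℝ) / N ≤ 1 := by
  refine div_le_one_of_le₀ ?_ (Nat.cast_nonneg N)
  have hq' : (1 : ℝ) < q := by exact_mod_cast hq
  rcases Nat.eq_zero_or_pos C.ncard with h | h
  · simp [h]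
  · rw [Real.logb_le_iff_le_rpow hq' (by exact_mod_cast h), Real.rpow_natCast]
    have : C.ncard ≤ q ^ N := by
      calc C.ncard ≤ (Set.univ : Set (Fin N → K)).ncard :=
            Set.ncard_le_ncard (Set.subset_univ C)
        _ = q ^ N := by rw [Set.ncard_univ, Nat.card_eq_fintype_card]; simp [hcard]
    exact_mod_cast this

lemma isBoundedUnder_rate {q : ℕ} (hcard : Fintype.card K = q) (hq : 1 < q) {N : ℕ → ℕ}
    (C : ∀ i, Set (Fin (N i) → K)) :
    IsBoundedUnder (· ≤ ·) atTop fun i => Real.logb q ((C i).ncard : ℝ) / (N i : ℝ) :=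
  isBoundedUnder_of ⟨1, fun _ => rate_le_one hcard hq _⟩

lemma isCoboundedUnder_rate {q : ℕ} (hq : 1 < q) {N : ℕ → ℕ}
    (C : ∀ i, Set (Fin (N i) → K)) :
    IsCoboundedUnder (· ≤ ·) atTop fun i => Real.logb q ((C i).ncard : ℝ) / (N i : ℝ) :=
  (isBoundedUnder_of ⟨0, fun _ => rate_nonneg hq _⟩ :
    IsBoundedUnder (· ≥ ·) atTop _).isCoboundedUnder_le

lemma tendsto_sqrt_add_one_div_atTop (a : ℝ) :
    Tendsto (fun N : ℕ => (a * √N + 1) / (N : ℝ)) atTop (nhds 0) := by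
  have h1 : Tendsto (fun N : ℕ => a * (√(N : ℝ))⁻¹ + ((N : ℝ))⁻¹) atTop (nhds (a * 0 + 0)) :=
    ((tendsto_inv_atTop_zero.comp
      (Real.tendsto_sqrt_atTop.comp tendsto_natCast_atTop_atTop)).const_mul a).add
      (tendsto_inv_atTop_zero.comp tendsto_natCast_atTop_atTop)
  rw [mul_zero, add_zero] at h1
  refine h1.congr fun N => ?_
  rw [add_div, mul_div_assoc, Real.sqrt_div_self', one_div, one_div]

lemma tendsto_logb_div_atTop (b : ℝ) :
    Tendsto (fun N : ℕ => Real.logb b (2 * (N + 1)) / (N : ℝ)) atTop (nhds 0) := by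
  have h1 : Tendsto (fun N : ℕ => Real.log (2 * (N + 1)) / (N : ℝ)) atTop (nhds 0) := by
    refine squeeze_zero' (Eventually.of_forall fun N => ?_) ?_ (tendsto_sqrt_add_one_div_atTop 4)
    · have hN : (0 : ℝ) ≤ N := Nat.cast_nonneg N
      exact div_nonneg (Real.log_nonneg (by linarith)) hN
    · filter_upwards [eventually_ge_atTop 1] with N hN
      have hN' : (1 : ℝ) ≤ N := by exact_mod_cast hN
      gcongr
      have h4 : (2 : ℝ) * (N + 1) ≤ (2 * √N) ^ 2 := by
        rw [mul_pow, Real.sq_sqrt (by linarith)]; linarith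
      have hs : 0 < √(N : ℝ) := Real.sqrt_pos.2 (by linarith)
      calc Real.log (2 * (N + 1)) ≤ Real.log ((2 * √N) ^ 2) :=
            Real.log_le_log (by linarith) h4
        _ = 2 * Real.log (2 * √N) := by rw [Real.log_pow]; norm_num
        _ ≤ 2 * (2 * √N - 1) := by
          gcongr
          exact Real.log_le_sub_one_of_pos (by positivity)
        _ ≤ 4 * √N + 1 := by linarith
  have h2 := h1.div_const (Real.log b)
  rw [zero_div] at h2
  refine h2.congr fun N => ?_
  rw [Real.logb, div_right_comm]

variable [Field K]

lemma RoptCW_nonneg {q : ℕ} (hcard : Fintype.card K = q) (hq : 1 < q) (δ ω : ℝ) :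
    0 ≤ RoptCW K q δ ω := by
  refine Real.sSup_nonneg ?_
  rintro _ ⟨N, C, w, -, -, -, -, -, rfl⟩
  exact le_limsup_of_frequently_le (Frequently.of_forall fun _ => rate_nonneg hq _)
    (isBoundedUnder_rate hcard hq C)

lemma limsup_rate_le_RoptCW {q : ℕ} (hcard : Fintype.card K = q) (hq : 1 < q) {δ ω : ℝ}
    {N : ℕ → ℕ} {C : ∀ i : ℕ, Set (Fin (N i) → K)} {w : ℕ → ℕ} (hN : StrictMono N)
    (hC : ∀ i, (C i).Nonempty) (hw : ∀ i, ∀ c ∈ C i, hammingNorm c = w i)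
    (hω : Tendsto (fun i => (w i : ℝ) / (N i : ℝ)) atTop (nhds ω))
    (hδ : δ ≤ liminf (fun i => (minDist (C i) : ℝ) / (N i : ℝ)) atTop) :
    limsup (fun i => Real.logb q ((C i).ncard : ℝ) / (N i : ℝ)) atTop ≤ RoptCW K q δ ω := by
  refine le_csSup ⟨1, ?_⟩ ⟨N, C, w, hN, hC, hw, hω, hδ, rfl⟩
  rintro _ ⟨N, C, w, -, -, -, -, -, rfl⟩
  exact limsup_le_of_le (isCoboundedUnder_rate hq C)
    (Eventually.of_forall fun _ => rate_le_one hcard hq _)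

end Asymptotics

/-- Theorem (general case, bound `R̂_2`): the rate of every linearly recoverable
`(δ,n)`-LRC sequence over `F` (not necessarily all-disjoint) is bounded from above by
`R̂_2(δ,n) = min_{ω ∈ [δ/2,(q-1)/q]} { R̂_0(ω,n) + R_opt(δ,ω) }`. -/
theorem bound2_nondisjoint
    (K : Type) [Field K] [Fintype K] [DecidableEq K]
    (q : ℕ) (hq : Fintype.card K = q)
    (n : ℕ) (hn : 2 ≤ n)
    (δ : ℝ) (hδ : δ ∈ Set.Ico (0:ℝ) (((q:ℝ) - 1) / q))
    -- the given linearly recoverable `(δ,n)`-LRC sequence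
    (N : ℕ → ℕ) (C : ∀ i : ℕ, Set (Fin (N i) → K))
    (hmono : StrictMono N) (hne : ∀ i, (C i).Nonempty)
    (hLRC : ∀ i, ∃ Rg : Fin (N i) → Finset (Fin (N i)), IsLinRecLRC (C i) n Rg)
    (hdist : δ ≤ liminf (fun i => (minDist (C i) : ℝ) / (N i : ℝ)) atTop)
    -- an arbitrary admissible `ω`
    (ω : ℝ) (hω : ω ∈ Set.Icc (δ / 2) (((q:ℝ) - 1) / q)) :
    limsup (fun i => Real.logb q ((C i).ncard : ℝ) / (N i : ℝ)) atTop
      ≤ Rhat0 q n ω + RoptCW K q δ ω := by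
  have hq2 : 1 < q := hq ▸ Fintype.one_lt_card
  have hq1 : (1 : ℝ) < q := by exact_mod_cast hq2
  have hω0 : 0 ≤ ω := by linarith [hδ.1, hω.1]
  by_contra! hlt
  obtain ⟨ε, hε, hlt'⟩ : ∃ ε : ℝ, 0 < ε ∧ Rhat0 q n ω + RoptCW K q δ ω + 2 * ε <
      limsup (fun i => Real.logb q ((C i).ncard : ℝ) / (N i : ℝ)) atTop := by
    obtain ⟨c, hc1, hc2⟩ := exists_between hlt
    exact ⟨(c - (Rhat0 q n ω + RoptCW K q δ ω)) / 2, by linarith, by linarith⟩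
  have hNtop : Tendsto N atTop atTop := hmono.tendsto_atTop
  have hfreq := (frequently_lt_of_lt_limsup (isCoboundedUnder_rate hq2 C) hlt').and_eventually
    ((hNtop.eventually_ge_atTop 1).and
      (hNtop.eventually ((tendsto_logb_div_atTop q).eventually_lt_const hε)))
  obtain ⟨φ, hφ, hP⟩ := extraction_of_frequently_atTop hfreq
  have hsub : ∀ k, ∃ (w : ℕ) (D : Set (Fin (N (φ k)) → K)) (x : Fin (N (φ k)) → K),
      D.Nonempty ∧ (∀ c ∈ D, hammingNorm c = w) ∧ (∀ c ∈ D, c + x ∈ C (φ k)) ∧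
      |(w : ℝ) - ω * N (φ k)| ≤ 4 * n * √(N (φ k)) + 1 ∧
      Real.logb q (C (φ k)).ncard ≤ Real.logb q D.ncard + N (φ k) * Rhat0 q n ω +
        Real.logb q (2 * (N (φ k) + 1)) := by
    intro k
    obtain ⟨Rg, hRg⟩ := hLRC (φ k)
    exact exists_constantWeight_subcode hq hn hω0 hω.2 (hP k).2.1 (hne (φ k)) hRg
  choose w D x hD hDw hDC hw hlog using hsub
  have hNpos : ∀ k, (0 : ℝ) < N (φ k) := fun k => by exact_mod_cast (hP k).2.1
  have hrate : ∀ k, RoptCW K q δ ω + ε ≤ Real.logb q ((D k).ncard : ℝ) / (N (φ k) : ℝ) := by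
    intro k
    have h1 := div_le_div_of_nonneg_right (hlog k) (hNpos k).le
    rw [add_div, add_div, mul_div_cancel_left₀ _ (hNpos k).ne'] at h1
    linarith [(hP k).1, (hP k).2.2]
  have hNφ : Tendsto (fun k => N (φ k)) atTop atTop := hNtop.comp hφ.tendsto_atTop
  have hnt : ∀ k, (D k).Nontrivial := by
    intro k
    rw [← Set.one_lt_ncard_iff_nontrivial]
    by_contra! hle
    have hzero : Real.logb q ((D k).ncard : ℝ) = 0 := by
      interval_cases (D k).ncard <;> simp
    have := hrate k
    rw [hzero, zero_div] at this
    linarith [RoptCW_nonneg hq hq2 δ ω]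
  have hbound : limsup (fun k => Real.logb q ((D k).ncard : ℝ) / (N (φ k) : ℝ)) atTop ≤
      RoptCW K q δ ω := by
    refine limsup_rate_le_RoptCW hq hq2 (hmono.comp hφ) hD hDw ?_ ?_
    · rw [tendsto_iff_dist_tendsto_zero]
      refine squeeze_zero (fun _ => dist_nonneg) (fun k => ?_)
        ((tendsto_sqrt_add_one_div_atTop (4 * n)).comp hNφ)
      have : (w k : ℝ) / N (φ k) - ω = (w k - ω * N (φ k)) / N (φ k) := by
        have := (hNpos k).ne'
        field_simp
      simp only [Function.comp_apply]
      rw [Real.dist_eq, this, abs_div, abs_of_pos (hNpos k)]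
      exact div_le_div_of_nonneg_right (hw k) (hNpos k).le
    · refine le_of_forall_lt_imp_le_of_dense fun b hb => ?_
      have hev := eventually_lt_of_lt_liminf (hb.trans_le hdist)
        (isBoundedUnder_of ⟨0, fun _ => by positivity⟩)
      refine le_liminf_of_le (isBoundedUnder_of
        ⟨1, fun _ => minDist_div_le_one _⟩ : IsBoundedUnder (· ≤ ·) atTop _).isCoboundedUnder_ge ?_
      filter_upwards [hφ.tendsto_atTop.eventually hev] with k hk
      refine hk.le.trans ?_
      have := minDist_le_of_translate (hDC k) (hnt k)
      gcongr
  have hge : RoptCW K q δ ω + ε ≤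
      limsup (fun k => Real.logb q ((D k).ncard : ℝ) / (N (φ k) : ℝ)) atTop :=
    le_limsup_of_frequently_le (Frequently.of_forall hrate) (isBoundedUnder_rate hq hq2 D)
  linarith
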